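/- Define, for β > 0, real n and τ > 0, G(β, n, τ) := −β τ³/24 + (√2/3) τ^{3/2} (βn + β/2 − 1) − (3/4) ( β n²/2 + (β/2 − 1) n + (1/6)(1 − (2/β)(1 − β/2)²) ) log τ. Fix β > 0, real n, and s > 0, and set s' := (β/2)^{2/3} s. Then the function τ ↦ G(β, n, s τ) − G(4/β, βn/2 + β/2 − 1, s' τ) is constant on (0, ∞). -/

import Mathlib

/-- The conjectured large-`|t|` expansion of `log E_β^soft(n;(t,∞))` (eq. (31h)),
written with `τ = |t| > 0`, so that `log |t|^{-3/4} = -(3/4) log τ`. -/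
noncomputable def Gsoft (β n τ : ℝ) : ℝ :=
  -β * τ ^ 3 / 24 + Real.sqrt 2 / 3 * τ ^ ((3:ℝ)/2) * (β * n + β / 2 - 1)
    - 3 / 4 * (β * n ^ 2 / 2 + (β / 2 - 1) * n
        + 1 / 6 * (1 - 2 / β * (1 - β / 2) ^ 2)) * Real.log τ

/-- Consistency of eq. (31h) with the soft-edge asymptotic duality (eq. (32z)):
with `s' = (β/2)^{2/3} s`, the difference of the two expansions is independent of `τ`. -/
theorem stmt16 (β n s s' : ℝ) (hβ : 0 < β) (hs : 0 < s)
    (hs' : s' = (β / 2) ^ ((2:ℝ)/3) * s) :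
    ∃ C : ℝ, ∀ τ : ℝ, 0 < τ →
      Gsoft β n (s * τ) - Gsoft (4 / β) (β * n / 2 + β / 2 - 1) (s' * τ) = C := by
  have hb : 0 < β / 2 := by positivity
  obtain ⟨c, hc⟩ : ∃ c, c = (β / 2) ^ ((2:ℝ)/3) := ⟨_, rfl⟩
  have hc0 : 0 < c := by rw [hc]; positivity
  have h3 : c ^ 3 = (β / 2) ^ 2 := by
    rw [hc, ← Real.rpow_natCast, ← Real.rpow_mul hb.le, ← Real.rpow_natCast]
    norm_num
  have h32 : c ^ ((3:ℝ)/2) = β / 2 := by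
    rw [hc, ← Real.rpow_mul hb.le]
    norm_num
  rw [← hc] at hs'
  refine ⟨3 / 4 * (β * n ^ 2 / 2 + (β / 2 - 1) * n
        + 1 / 6 * (1 - 2 / β * (1 - β / 2) ^ 2)) * Real.log c, fun τ hτ => ?_⟩
  have hx : 0 < s * τ := by positivity
  have e : s' * τ = c * (s * τ) := by rw [hs']; ring
  rw [e]
  generalize s * τ = x at hx
  unfold Gsoft
  rw [Real.mul_rpow hc0.le hx.le, Real.log_mul hc0.ne' hx.ne', mul_pow, h3, h32]
  generalize Real.log x = L
  generalize Real.log c = M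
  generalize x ^ ((3:ℝ)/2) = y
  generalize Real.sqrt 2 = q
  field_simp
  ring
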